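/- Let d ≥ 2 and let ψ, φ be Schwartz functions on ℝ^d with ∫_{ℝ^d} ψ(x) dx = 0 and ∫_{ℝ^d} φ(x) dx = 0. Then there exists a constant C = C(d, ψ, φ) such that for every locally integrable f on ℝ^d, all j, k ∈ ℤ and every x ∈ ℝ^d, |ψ_k * φ_j * f(x)| ≤ C 2^{−|j−k|} M f(x), where M is the Hardy–Littlewood maximal function. -/

import Mathlib

open MeasureTheory Metric Filter
open scoped ENNReal FourierTransform Pointwise Topology

noncomputable section

/-- Dyadic dilate `φ_j(x) = 2^{-jd} φ(2^{-j} x)`. -/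
def dilR (d : ℕ) (φ : EuclideanSpace ℝ (Fin d) → ℝ) (j : ℤ)
    (x : EuclideanSpace ℝ (Fin d)) : ℝ :=
  (2:ℝ) ^ (-(j * (d:ℤ))) * φ ((2:ℝ) ^ (-j) • x)

/-- Convolution `g * f (x) = ∫ g(y) f(x-y) dy`. -/
def convR (d : ℕ) (g f : EuclideanSpace ℝ (Fin d) → ℝ)
    (x : EuclideanSpace ℝ (Fin d)) : ℝ :=
  ∫ y, g y * f (x - y)

/-- The Hardy–Littlewood maximal function
`M f(x) = sup_{r>0} |B(x,r)|⁻¹ ∫_{B(x,r)} |f|`. -/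
def HLmax (d : ℕ) (f : EuclideanSpace ℝ (Fin d) → ℝ) (x : EuclideanSpace ℝ (Fin d)) : ℝ≥0∞ :=
  ⨆ (r : ℝ) (_ : 0 < r), (volume (ball x r))⁻¹ * ∫⁻ y in ball x r, (‖f y‖₊ : ℝ≥0∞)

section SchwartzEstimates

variable {E : Type*} [NormedAddCommGroup E] [NormedSpace ℝ E]

lemma schwartz_abs_sub_le (φ : SchwartzMap E ℝ) (N : ℕ) :
    ∃ C : ℝ, 0 ≤ C ∧ ∀ u v : E,
      |φ (u - v) - φ u| ≤ C * (‖v‖ * (1 + ‖v‖) ^ N) / (1 + ‖u‖) ^ N := by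
  obtain ⟨C, hC0, hC⟩ : ∃ C : ℝ, 0 ≤ C ∧ ∀ p : E, (1 + ‖p‖) ^ N * ‖fderiv ℝ φ p‖ ≤ C := by
    have h := SchwartzMap.one_add_le_sup_seminorm_apply (𝕜 := ℝ) (m := (N, 1)) (k := N) (n := 1)
      le_rfl le_rfl φ
    simp_rw [norm_iteratedFDeriv_one] at h
    exact ⟨_, le_trans (by positivity) (h 0), h⟩
  refine ⟨C, hC0, fun u v => ?_⟩
  have hu : 0 < (1 + ‖u‖) ^ N := by positivity
  have key : ∀ p ∈ segment ℝ u (u - v),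
      ‖fderiv ℝ φ p‖ ≤ C * (1 + ‖v‖) ^ N / (1 + ‖u‖) ^ N := by
    intro p hp
    have hup : ‖u - p‖ ≤ ‖v‖ := by
      have h := norm_sub_le_of_mem_segment hp
      rw [norm_sub_rev]
      simpa using h
    have htri : 1 + ‖u‖ ≤ (1 + ‖p‖) * (1 + ‖v‖) := by
      have h : ‖u‖ ≤ ‖u - p‖ + ‖p‖ := by simpa using norm_add_le (u - p) p
      nlinarith [norm_nonneg p, norm_nonneg v]
    rw [le_div_iff₀ hu]
    calc ‖fderiv ℝ φ p‖ * (1 + ‖u‖) ^ N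
        ≤ ‖fderiv ℝ φ p‖ * ((1 + ‖p‖) * (1 + ‖v‖)) ^ N := by gcongr
      _ = ((1 + ‖p‖) ^ N * ‖fderiv ℝ φ p‖) * (1 + ‖v‖) ^ N := by rw [mul_pow]; ring
      _ ≤ C * (1 + ‖v‖) ^ N := by gcongr; exact hC p
  have h := (convex_segment u (u - v)).norm_image_sub_le_of_norm_fderiv_le (𝕜 := ℝ)
    (fun p _ => φ.differentiableAt) key (left_mem_segment ℝ u (u - v))
    (right_mem_segment ℝ u (u - v))
  rw [Real.norm_eq_abs] at h
  refine h.trans_eq ?_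
  rw [sub_sub_cancel_left, norm_neg]
  ring

variable [FiniteDimensional ℝ E] [MeasurableSpace E] [BorelSpace E]
  (μ : Measure E) [μ.IsAddHaarMeasure]

lemma schwartz_integrable_one_add_norm_pow_mul (ψ : SchwartzMap E ℝ) (N : ℕ) :
    Integrable (fun w => (1 + ‖w‖) ^ N * ‖ψ w‖) μ := by
  have h0 : Integrable (fun w => 2 ^ (N - 1) * (‖ψ w‖ + ‖w‖ ^ N * ‖ψ w‖)) μ :=
    ((ψ.integrable (μ := μ)).norm.add (ψ.integrable_pow_mul μ N)).const_mul _
  refine h0.mono' ?_ (Eventually.of_forall fun w => ?_)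
  · have := ψ.continuous
    exact (by fun_prop : Continuous fun w => (1 + ‖w‖) ^ N * ‖ψ w‖).aestronglyMeasurable
  · rw [Real.norm_of_nonneg (by positivity)]
    have h := add_pow_le zero_le_one (norm_nonneg w) N
    calc (1 + ‖w‖) ^ N * ‖ψ w‖ ≤ (2 ^ (N - 1) * (1 ^ N + ‖w‖ ^ N)) * ‖ψ w‖ := by gcongr
      _ = _ := by rw [one_pow]; ring

lemma schwartz_abs_integral_mul_comp_sub_smul_le (ψ φ : SchwartzMap E ℝ)
    (hψ : ∫ x, ψ x ∂μ = 0) (N : ℕ) :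
    ∃ C : ℝ, 0 ≤ C ∧ ∀ (u : E) (t : ℝ), 0 < t → t ≤ 1 →
      |∫ w, ψ w * φ (u - t • w) ∂μ| ≤ C * t / (1 + ‖u‖) ^ N := by
  obtain ⟨C, hC0, hC⟩ := schwartz_abs_sub_le φ N
  have hint := schwartz_integrable_one_add_norm_pow_mul μ ψ (N + 1)
  refine ⟨C * ∫ w, (1 + ‖w‖) ^ (N + 1) * ‖ψ w‖ ∂μ,
    mul_nonneg hC0 (integral_nonneg fun w => by positivity), fun u t ht0 ht1 => ?_⟩
  have hi : Integrable (fun w => ψ w * φ (u - t • w)) μ := by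
    refine (ψ.integrable (μ := μ)).mul_bdd (c := SchwartzMap.seminorm ℝ 0 0 φ) ?_ ?_
    · have := φ.continuous
      exact (by fun_prop : Continuous fun w => φ (u - t • w)).aestronglyMeasurable
    · exact Eventually.of_forall fun w => SchwartzMap.norm_le_seminorm ℝ φ _
  have hsub : ∫ w, ψ w * φ (u - t • w) ∂μ = ∫ w, ψ w * (φ (u - t • w) - φ u) ∂μ := by
    simp_rw [mul_sub]
    rw [integral_sub hi ((ψ.integrable (μ := μ)).mul_const _), integral_mul_const, hψ]
    simp
  rw [hsub, ← Real.norm_eq_abs]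
  calc ‖∫ w, ψ w * (φ (u - t • w) - φ u) ∂μ‖
      ≤ ∫ w, (C * t / (1 + ‖u‖) ^ N) * ((1 + ‖w‖) ^ (N + 1) * ‖ψ w‖) ∂μ := by
        refine norm_integral_le_of_norm_le (hint.const_mul _) (Eventually.of_forall fun w => ?_)
        have htw : ‖t • w‖ = t * ‖w‖ := by rw [norm_smul, Real.norm_of_nonneg ht0.le]
        have htw1 : t * ‖w‖ ≤ ‖w‖ := mul_le_of_le_one_left (norm_nonneg w) ht1
        rw [norm_mul, Real.norm_eq_abs (_ - _)]
        calc ‖ψ w‖ * |φ (u - t • w) - φ u|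
            ≤ ‖ψ w‖ * (C * (t * (1 + ‖w‖) * (1 + ‖w‖) ^ N) / (1 + ‖u‖) ^ N) := by
              gcongr
              refine (hC u (t • w)).trans ?_
              rw [htw]
              gcongr
              linarith
          _ = _ := by rw [pow_succ]; ring
    _ = _ := by rw [integral_const_mul]; ring

end SchwartzEstimates

lemma convR_comm (d : ℕ) (g f : EuclideanSpace ℝ (Fin d) → ℝ) : convR d g f = convR d f g := by
  funext x
  unfold convR
  rw [← integral_sub_left_eq_self _ volume x]
  simp only [sub_sub_cancel]
  exact integral_congr_ae (Eventually.of_forall fun y => mul_comm _ _)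

lemma convR_dilR (d : ℕ) (ψ φ : EuclideanSpace ℝ (Fin d) → ℝ) (j k : ℤ)
    (y : EuclideanSpace ℝ (Fin d)) :
    convR d (dilR d ψ k) (dilR d φ j) y =
      (2:ℝ) ^ (-(j * (d:ℤ))) *
        ∫ w, ψ w * φ ((2:ℝ) ^ (-j) • y - (2:ℝ) ^ (k - j) • w) := by
  have h := Measure.integral_comp_smul volume
    (fun w => ψ w * φ ((2:ℝ) ^ (-j) • y - (2:ℝ) ^ (k - j) • w)) ((2:ℝ) ^ (-k))
  have h2 : |(((2:ℝ) ^ (-k)) ^ d)⁻¹| = ((2:ℝ) ^ (-(k * (d:ℤ))))⁻¹ := by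
    rw [abs_of_pos (by positivity), ← zpow_natCast, ← zpow_mul, neg_mul]
  rw [finrank_euclideanSpace_fin, h2, smul_eq_mul] at h
  have h3 : ∀ z : EuclideanSpace ℝ (Fin d), dilR d ψ k z * dilR d φ j (y - z) =
      ((2:ℝ) ^ (-(k * (d:ℤ))) * (2:ℝ) ^ (-(j * (d:ℤ)))) *
        (ψ ((2:ℝ) ^ (-k) • z) *
          φ ((2:ℝ) ^ (-j) • y - (2:ℝ) ^ (k - j) • (2:ℝ) ^ (-k) • z)) := by
    intro z
    unfold dilR
    rw [smul_smul ((2:ℝ) ^ (k - j)), ← zpow_add₀ (two_ne_zero' ℝ) (k - j) (-k),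
      show k - j + -k = -j by ring, ← smul_sub]
    ring
  unfold convR
  simp_rw [h3]
  rw [integral_const_mul, h]
  have : (2:ℝ) ^ (-(k * (d:ℤ))) ≠ 0 := by positivity
  field_simp

lemma lintegral_ball_le_HLmax (d : ℕ) (f : EuclideanSpace ℝ (Fin d) → ℝ)
    (x : EuclideanSpace ℝ (Fin d)) {r : ℝ} (hr : 0 < r) :
    ∫⁻ y in ball x r, (‖f y‖₊ : ℝ≥0∞) ≤ volume (ball x r) * HLmax d f x := by
  have h : (volume (ball x r))⁻¹ * ∫⁻ y in ball x r, (‖f y‖₊ : ℝ≥0∞) ≤ HLmax d f x :=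
    le_iSup₂ (f := fun (r : ℝ) (_ : 0 < r) =>
      (volume (ball x r))⁻¹ * ∫⁻ y in ball x r, (‖f y‖₊ : ℝ≥0∞)) r hr
  rwa [ENNReal.inv_mul_le_iff (measure_ball_pos volume x hr).ne' measure_ball_lt_top.ne] at h

lemma lintegral_one_add_norm_inv_pow_mul_le_HLmax (d : ℕ)
    (f : EuclideanSpace ℝ (Fin d) → ℝ) (hf : AEStronglyMeasurable f volume)
    (x : EuclideanSpace ℝ (Fin d)) {s : ℝ} (hs : 0 < s) :
    ∫⁻ z, ENNReal.ofReal (s ^ d / (1 + s * ‖x - z‖) ^ (d + 1)) * (‖f z‖₊ : ℝ≥0∞) ≤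
      ENNReal.ofReal (2 ^ (d + 2)) * volume (ball (0 : EuclideanSpace ℝ (Fin d)) 1) *
        HLmax d f x := by
  set c : ℕ → ℝ := fun n => s ^ d * 2 ^ (d + 1) / (2 ^ n) ^ (d + 1) with hc
  have hc0 : ∀ n, 0 < c n := fun n => by positivity
  have hr : ∀ n : ℕ, 0 < 2 ^ n / s := fun n => by positivity
  have hpt : ∀ z, ENNReal.ofReal (s ^ d / (1 + s * ‖x - z‖) ^ (d + 1)) * (‖f z‖₊ : ℝ≥0∞) ≤
      ∑' n : ℕ, (ball x (2 ^ n / s)).indicator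
        (fun z => ENNReal.ofReal (c n) * (‖f z‖₊ : ℝ≥0∞)) z := by
    intro z
    have h1 : 1 ≤ 1 + s * ‖x - z‖ := by
      have : 0 ≤ s * ‖x - z‖ := by positivity
      linarith
    obtain ⟨m, hm1, hm2⟩ := exists_nat_pow_near h1 one_lt_two
    refine le_trans ?_ (ENNReal.le_tsum (m + 1))
    rw [Set.indicator_of_mem]
    · gcongr
      rw [hc]
      simp only
      rw [pow_succ 2 m, mul_pow, mul_div_mul_right _ _ (by positivity)]
      gcongr
    · rw [mem_ball', dist_eq_norm, lt_div_iff₀ hs]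
      linarith
  have hball : ∀ n : ℕ, volume (ball x (2 ^ n / s)) =
      ENNReal.ofReal ((2 ^ n / s) ^ d) * volume (ball (0 : EuclideanSpace ℝ (Fin d)) 1) := by
    intro n
    rw [Measure.addHaar_ball_of_pos volume x (hr n), finrank_euclideanSpace_fin]
  have hcoef : ∀ n : ℕ, c n * (2 ^ n / s) ^ d = 2 ^ (d + 1) * (1 / 2) ^ n := by
    intro n
    rw [hc]
    simp only
    rw [div_pow, one_div, inv_pow, pow_succ ((2:ℝ) ^ n) d]
    field_simp
  calc ∫⁻ z, ENNReal.ofReal (s ^ d / (1 + s * ‖x - z‖) ^ (d + 1)) * (‖f z‖₊ : ℝ≥0∞)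
      ≤ ∫⁻ z, ∑' n : ℕ, (ball x (2 ^ n / s)).indicator
        (fun z => ENNReal.ofReal (c n) * (‖f z‖₊ : ℝ≥0∞)) z := lintegral_mono hpt
    _ = ∑' n : ℕ, ENNReal.ofReal (c n) * ∫⁻ z in ball x (2 ^ n / s), (‖f z‖₊ : ℝ≥0∞) := by
        have hf' : AEMeasurable (fun z => (‖f z‖₊ : ℝ≥0∞)) volume := hf.enorm
        rw [lintegral_tsum fun n => (hf'.const_mul _).indicator measurableSet_ball]
        refine tsum_congr fun n => ?_
        rw [lintegral_indicator measurableSet_ball, lintegral_const_mul' _ _ ENNReal.ofReal_ne_top]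
    _ ≤ ∑' n : ℕ, ENNReal.ofReal (2 ^ (d + 1) * (1 / 2) ^ n) *
          (volume (ball (0 : EuclideanSpace ℝ (Fin d)) 1) * HLmax d f x) := by
        refine ENNReal.tsum_le_tsum fun n => ?_
        rw [← hcoef n, ENNReal.ofReal_mul (hc0 n).le, mul_assoc, ← mul_assoc (ENNReal.ofReal (_ ^ d)),
          ← hball n]
        gcongr
        exact lintegral_ball_le_HLmax d f x (hr n)
    _ = _ := by
        rw [ENNReal.tsum_mul_right, ← ENNReal.ofReal_tsum_of_nonneg (fun n => by positivity)
          (summable_geometric_two.mul_left _), tsum_mul_left, tsum_geometric_two, ← pow_succ,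
          mul_assoc]

lemma enorm_convR_le_HLmax (d : ℕ) (K f : EuclideanSpace ℝ (Fin d) → ℝ)
    (hf : AEStronglyMeasurable f volume) (x : EuclideanSpace ℝ (Fin d)) {A s : ℝ} (hA : 0 ≤ A)
    (hs : 0 < s) (hK : ∀ y, |K y| ≤ A * (s ^ d / (1 + s * ‖y‖) ^ (d + 1))) :
    (‖convR d K f x‖₊ : ℝ≥0∞) ≤
      ENNReal.ofReal A * (ENNReal.ofReal (2 ^ (d + 2)) *
        volume (ball (0 : EuclideanSpace ℝ (Fin d)) 1) * HLmax d f x) := by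
  calc (‖convR d K f x‖₊ : ℝ≥0∞)
      ≤ ∫⁻ y, ‖K y * f (x - y)‖ₑ := enorm_integral_le_lintegral_enorm _
    _ = ∫⁻ z, ‖K (x - z) * f z‖ₑ := by
        rw [← lintegral_sub_left_eq_self _ x]
        simp only [sub_sub_cancel]
    _ ≤ ∫⁻ z, ENNReal.ofReal A *
          (ENNReal.ofReal (s ^ d / (1 + s * ‖x - z‖) ^ (d + 1)) * (‖f z‖₊ : ℝ≥0∞)) := by
        refine lintegral_mono fun z => ?_
        rw [enorm_mul, ← mul_assoc, ← ENNReal.ofReal_mul hA, Real.enorm_eq_ofReal_abs (K _)]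
        gcongr
        · exact hK _
        · exact le_rfl
    _ ≤ _ := by
        rw [lintegral_const_mul' _ _ ENNReal.ofReal_ne_top]
        gcongr
        exact lintegral_one_add_norm_inv_pow_mul_le_HLmax d f hf x hs

lemma abs_convR_dilR_le (d : ℕ) (ψ φ : SchwartzMap (EuclideanSpace ℝ (Fin d)) ℝ)
    (hψ : ∫ x, ψ x = 0) :
    ∃ C : ℝ, 0 ≤ C ∧ ∀ j k : ℤ, k ≤ j → ∀ y : EuclideanSpace ℝ (Fin d),
      |convR d (dilR d ψ k) (dilR d φ j) y| ≤
        (C * (2:ℝ) ^ (-|j - k|)) *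
          (((2:ℝ) ^ (-j)) ^ d / (1 + (2:ℝ) ^ (-j) * ‖y‖) ^ (d + 1)) := by
  obtain ⟨C, hC0, hC⟩ := schwartz_abs_integral_mul_comp_sub_smul_le volume ψ φ hψ (d + 1)
  refine ⟨C, hC0, fun j k hkj y => ?_⟩
  have h := hC ((2:ℝ) ^ (-j) • y) ((2:ℝ) ^ (k - j)) (by positivity)
    (zpow_le_one_of_nonpos₀ one_le_two (by lia))
  rw [norm_smul, Real.norm_of_nonneg (by positivity : (0:ℝ) ≤ 2 ^ (-j))] at h
  rw [convR_dilR, abs_mul, abs_of_pos (by positivity : (0:ℝ) < 2 ^ (-(j * (d:ℤ)))),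
    abs_of_nonneg (by lia : 0 ≤ j - k), neg_sub, ← zpow_natCast ((2:ℝ) ^ (-j)) d, ← zpow_mul,
    neg_mul]
  exact (mul_le_mul_of_nonneg_left h (by positivity)).trans_eq (by ring)

/-- For Schwartz `ψ, φ` with vanishing integrals there is `C = C(d,ψ,φ)` so that for every
locally integrable `f`, all `j,k ∈ ℤ` and `x ∈ ℝ^d`,
`|ψ_k * φ_j * f(x)| ≤ C 2^{-|j-k|} M f(x)`. -/
theorem almost_orthogonality_pointwise (d : ℕ) (hd : 2 ≤ d)
    (ψ φ : SchwartzMap (EuclideanSpace ℝ (Fin d)) ℝ)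
    (hψ : ∫ x, ψ x = 0) (hφ : ∫ x, φ x = 0) :
    ∃ C : ℝ, 0 < C ∧ ∀ f : EuclideanSpace ℝ (Fin d) → ℝ,
      LocallyIntegrable f volume → ∀ j k : ℤ, ∀ x : EuclideanSpace ℝ (Fin d),
        (‖convR d (convR d (dilR d (⇑ψ) k) (dilR d (⇑φ) j)) f x‖₊ : ℝ≥0∞) ≤
          ENNReal.ofReal (C * (2:ℝ) ^ (-|j - k|)) * HLmax d f x := by
  obtain ⟨C₁, hC₁, h₁⟩ := abs_convR_dilR_le d ψ φ hψ
  obtain ⟨C₂, hC₂, h₂⟩ := abs_convR_dilR_le d φ ψ hφ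
  set v : ℝ := (volume (ball (0 : EuclideanSpace ℝ (Fin d)) 1)).toReal with hv
  have hv0 : 0 ≤ v := ENNReal.toReal_nonneg
  have hvol : volume (ball (0 : EuclideanSpace ℝ (Fin d)) 1) = ENNReal.ofReal v :=
    (ENNReal.ofReal_toReal measure_ball_lt_top.ne).symm
  refine ⟨(C₁ + C₂) * (2 ^ (d + 2) * v) + 1, by positivity, fun f hf j k x => ?_⟩
  obtain ⟨s, hs, hK⟩ : ∃ s : ℝ, 0 < s ∧ ∀ y,
      |convR d (dilR d ψ k) (dilR d φ j) y| ≤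
        ((C₁ + C₂) * (2:ℝ) ^ (-|j - k|)) * (s ^ d / (1 + s * ‖y‖) ^ (d + 1)) := by
    rcases le_total k j with hkj | hjk
    · refine ⟨(2:ℝ) ^ (-j), by positivity, fun y => (h₁ j k hkj y).trans ?_⟩
      gcongr
      linarith
    · refine ⟨(2:ℝ) ^ (-k), by positivity, fun y => ?_⟩
      rw [convR_comm, abs_sub_comm j k]
      refine (h₂ k j hjk y).trans ?_
      gcongr
      linarith
  refine (enorm_convR_le_HLmax d _ f hf.aestronglyMeasurable x (by positivity) hs hK).trans ?_
  rw [hvol, ← ENNReal.ofReal_mul (by positivity), ← mul_assoc,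
    ← ENNReal.ofReal_mul (by positivity)]
  refine mul_le_mul_left (ENNReal.ofReal_le_ofReal ?_) _
  have : (0:ℝ) < 2 ^ (-|j - k|) := by positivity
  nlinarith
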